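/- arXiv:2105.09217 — 8 statements merged into one kernel-verified Lean document; each statement's English description precedes it below -/
import Mathlib

section
/- Let x be a point of the Euclidean plane ℝ², let r ≥ 0 be a real number, and let a, b, c be three pairwise distinct points of ℝ² each at Euclidean distance at most r from x. Then the minimum of the three quantities d(a,b)+d(a,c), d(b,a)+d(b,c), d(c,a)+d(c,b) is at most 2√3·r (the extremal configuration being an equilateral triangle inscribed in the circle of radius r). -/
/-- three pairwise distinct points of the plane at distance at most `r`
from a common point `x` have 2-dispersion cost at most `2√3·r`. -/
theorem three_points_in_disk_cost_bound
    (x a b c : EuclideanSpace ℝ (Fin 2)) (r : ℝ) (hr : 0 ≤ r)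
    (hab : a ≠ b) (hac : a ≠ c) (hbc : b ≠ c)
    (ha : dist a x ≤ r) (hb : dist b x ≤ r) (hc : dist c x ≤ r) :
    min (min (dist a b + dist a c) (dist b a + dist b c)) (dist c a + dist c b)
      ≤ 2 * Real.sqrt 3 * r := by
  have key : dist a b ^ 2 + dist a c ^ 2 + dist b c ^ 2 ≤ 9 * r ^ 2 := by
    have e : ∀ p q : EuclideanSpace ℝ (Fin 2), dist p q ^ 2 =
        ‖p - x‖ ^ 2 - 2 * inner ℝ (p - x) (q - x) + ‖q - x‖ ^ 2 := by
      intro p q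
      rw [← norm_sub_sq_real, dist_eq_norm]
      congr 2
      abel
    have h0 := sq_nonneg ‖(a - x) + (b - x) + (c - x)‖
    rw [norm_add_sq_real, norm_add_sq_real, inner_add_left] at h0
    rw [dist_eq_norm] at ha hb hc
    have ha2 := pow_le_pow_left₀ (norm_nonneg _) ha 2
    have hb2 := pow_le_pow_left₀ (norm_nonneg _) hb 2
    have hc2 := pow_le_pow_left₀ (norm_nonneg _) hc 2
    rw [e a b, e a c, e b c]
    linarith
  have h3 : Real.sqrt 3 ^ 2 = 3 := Real.sq_sqrt (by norm_num)
  have per : dist a b + dist a c + dist b c ≤ 3 * Real.sqrt 3 * r := by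
    refine (sq_le_sq₀ (by positivity) (by positivity)).1 ?_
    have : (3 * Real.sqrt 3 * r) ^ 2 = 27 * r ^ 2 := by
      rw [mul_pow, mul_pow, h3]; ring
    rw [this]
    nlinarith [sq_nonneg (dist a b - dist a c), sq_nonneg (dist a b - dist b c),
      sq_nonneg (dist a c - dist b c)]
  rw [dist_comm b a, dist_comm c a, dist_comm c b]
  by_contra! h
  rw [lt_min_iff, lt_min_iff] at h
  obtain ⟨⟨h1, h2⟩, h4⟩ := h
  linarith
end

section
/- Let P be a finite set of n points in the Euclidean plane, let k be an integer with 3 ≤ k ≤ n, and let ε > 0. Suppose S₃ ⊆ P is a 3-element subset maximizing cost₂ among all 3-element subsets of P, and for each i = 3, 4, …, k−1 the set S_{i+1} = S_i ∪ {p} for some point p ∈ P∖S_i chosen so that cost₂(S_i ∪ {p}) ≥ cost₂(S_i ∪ {q}) for every q ∈ P∖S_i. Then for every k-element subset T ⊆ P one has cost₂(T) ≤ (2√3 + ε)·cost₂(S_k); that is, the greedy algorithm is a (2√3+ε)-factor approximation for the 2-dispersion problem. -/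
open scoped Classical

/-- `cost₂(p, S)`: the minimum over pairs of distinct points `q, q' ∈ S \ {p}` of
`d(p,q) + d(p,q')`. -/
noncomputable def cost2At (p : EuclideanSpace ℝ (Fin 2))
    (S : Finset (EuclideanSpace ℝ (Fin 2))) : ℝ :=
  sInf {x : ℝ | ∃ q ∈ S.erase p, ∃ q' ∈ S.erase p, q ≠ q' ∧ x = dist p q + dist p q'}

/-- `cost₂(S) = min_{p ∈ S} cost₂(p, S)`. -/
noncomputable def cost2 (S : Finset (EuclideanSpace ℝ (Fin 2))) : ℝ :=
  sInf {x : ℝ | ∃ p ∈ S, x = cost2At p S}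

abbrev E2 := EuclideanSpace ℝ (Fin 2)

/-- All two-edge stars on distinct points of `S` have length at least `c`. -/
def TripGe (c : ℝ) (S : Finset E2) : Prop :=
  ∀ p ∈ S, ∀ q ∈ S, ∀ r ∈ S, q ≠ p → r ≠ p → q ≠ r → c ≤ dist p q + dist p r

lemma cost2At_nonneg (p : E2) (S : Finset E2) : 0 ≤ cost2At p S := by
  apply Real.sInf_nonneg
  rintro x ⟨q, _, r, _, _, rfl⟩
  positivity

lemma cost2_nonneg (S : Finset E2) : 0 ≤ cost2 S := by
  apply Real.sInf_nonneg
  rintro x ⟨q, _, rfl⟩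
  exact cost2At_nonneg _ _

lemma tripGe_cost2 (S : Finset E2) : TripGe (cost2 S) S := by
  intro p hp q hq r hr hqp hrp hqr
  have h1 : cost2 S ≤ cost2At p S := by
    apply csInf_le
    · refine ⟨0, ?_⟩
      rintro x ⟨q, _, rfl⟩
      exact cost2At_nonneg _ _
    · exact ⟨p, hp, rfl⟩
  have h2 : cost2At p S ≤ dist p q + dist p r := by
    apply csInf_le
    · refine ⟨0, ?_⟩
      rintro x ⟨q, _, r, _, _, rfl⟩
      positivity
    · exact ⟨q, Finset.mem_erase.2 ⟨hqp, hq⟩, r, Finset.mem_erase.2 ⟨hrp, hr⟩, hqr, rfl⟩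
  exact h1.trans h2

lemma le_cost2 {c : ℝ} {S : Finset E2} (hS : 3 ≤ S.card) (h : TripGe c S) : c ≤ cost2 S := by
  apply le_csInf
  · obtain ⟨p, hp⟩ : S.Nonempty := Finset.card_pos.1 (by omega)
    exact ⟨_, p, hp, rfl⟩
  · rintro x ⟨p, hp, rfl⟩
    apply le_csInf
    · have : 1 < (S.erase p).card := by rw [Finset.card_erase_of_mem hp]; omega
      obtain ⟨a, ha, b, hb, hab⟩ := Finset.one_lt_card.1 this
      exact ⟨_, a, ha, b, hb, hab, rfl⟩
    · rintro x ⟨q, hq, r, hr, hqr, rfl⟩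
      rw [Finset.mem_erase] at hq hr
      exact h p hp q hq.2 r hr.2 hq.1 hr.1 hqr

lemma tri_geom {O l : ℝ} (hl : O = 2 * Real.sqrt 3 * l) {a b c q : E2}
    (ha : dist a q < l) (hb : dist b q < l) (hc : dist c q < l)
    (h1 : O ≤ dist a b + dist a c) (h2 : O ≤ dist b a + dist b c)
    (h3 : O ≤ dist c a + dist c b) : False := by
  have key : dist a b ^ 2 + dist a c ^ 2 + dist b c ^ 2
      ≤ 3 * (dist a q ^ 2 + dist b q ^ 2 + dist c q ^ 2) := by
    simp only [EuclideanSpace.dist_sq_eq, Fin.sum_univ_two, Real.dist_eq, sq_abs]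
    nlinarith [sq_nonneg (a 0 + b 0 + c 0 - 3 * q 0), sq_nonneg (a 1 + b 1 + c 1 - 3 * q 1)]
  rw [dist_comm b a] at h2
  rw [dist_comm c a, dist_comm c b] at h3
  have ha0 : 0 ≤ dist a q := dist_nonneg
  have hb0 : 0 ≤ dist b q := dist_nonneg
  have hc0 : 0 ≤ dist c q := dist_nonneg
  have e1 : dist a q ^ 2 < l ^ 2 := by gcongr
  have e2 : dist b q ^ 2 < l ^ 2 := by gcongr
  have e3 : dist c q ^ 2 < l ^ 2 := by gcongr
  generalize dist a b = x at *
  generalize dist a c = y at *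
  generalize dist b c = z at *
  have hlp : 0 < l := by linarith
  have hs : Real.sqrt 3 ^ 2 = 3 := Real.sq_sqrt (by norm_num)
  have hs0 : 0 ≤ Real.sqrt 3 := Real.sqrt_nonneg _
  have h4 : 3 * Real.sqrt 3 * l ≤ x + y + z := by linarith
  have h5 : (3 * Real.sqrt 3 * l) ^ 2 ≤ (x + y + z) ^ 2 := by gcongr
  have h6 : (3 * Real.sqrt 3 * l) ^ 2 = 27 * l ^ 2 := by
    rw [mul_pow, mul_pow, hs]; ring
  nlinarith [sq_nonneg (x - y), sq_nonneg (x - z), sq_nonneg (y - z)]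

lemma step {O l : ℝ} (hl : O = 2 * Real.sqrt 3 * l) {S T : Finset E2}
    (hcard : S.card < T.card) (hS : TripGe l S) (hT : TripGe O T) :
    ∃ t ∈ T \ S, TripGe l (insert t S) := by
  by_contra hcon
  push Not at hcon
  have bad : ∀ t ∈ T \ S, ∃ q ∈ S, ∃ r ∈ S, q ≠ r ∧ dist t q < l ∧ dist t r < l ∧
      dist q r < l := by
    intro t ht
    have h := hcon t ht
    have htS := (Finset.mem_sdiff.1 ht).2
    unfold TripGe at h
    push Not at h
    obtain ⟨p, hp, q, hq, r, hr, hqp, hrp, hqr, hlt⟩ := h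
    have n1 : 0 ≤ dist p q := dist_nonneg
    have n2 : 0 ≤ dist p r := dist_nonneg
    have n3 : dist q r ≤ dist p q + dist p r := dist_triangle_left q r p
    rw [Finset.mem_insert] at hp hq hr
    by_cases hpt : p = t
    · subst hpt
      exact ⟨q, hq.resolve_left hqp, r, hr.resolve_left hrp, hqr, by linarith, by linarith,
        by linarith⟩
    have hpS := hp.resolve_left hpt
    by_cases hqt : q = t
    · subst hqt
      exact ⟨p, hpS, r, hr.resolve_left (Ne.symm hqr), Ne.symm hrp,
        by rw [dist_comm]; linarith, by linarith, by linarith⟩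
    have hqS := hq.resolve_left hqt
    by_cases hrt : r = t
    · subst hrt
      exact ⟨p, hpS, q, hqS, Ne.symm hqp,
        by rw [dist_comm]; linarith, by rw [dist_comm]; linarith, by linarith⟩
    have := hS p hpS q hqS r (hr.resolve_left hrt) hqp hrp hqr
    linarith
  choose! f hf g hg hfg h1 h2 h3 using bad
  set A := (S ∩ T).filter (fun s => ∀ t ∈ T \ S, s ≠ f t ∧ s ≠ g t) with hA
  have hAS : A ⊆ S := fun x hx => (Finset.mem_inter.1 (Finset.mem_filter.1 hx).1).1
  have hAT : A ⊆ T := fun x hx => (Finset.mem_inter.1 (Finset.mem_filter.1 hx).1).2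
  have hfA : ∀ t ∈ T \ S, f t ∈ S \ A := fun t ht =>
    Finset.mem_sdiff.2 ⟨hf t ht, fun h => ((Finset.mem_filter.1 h).2 t ht).1 rfl⟩
  have hgA : ∀ t ∈ T \ S, g t ∈ S \ A := fun t ht =>
    Finset.mem_sdiff.2 ⟨hg t ht, fun h => ((Finset.mem_filter.1 h).2 t ht).2 rfl⟩
  have hmain : (T \ A).card * 2 ≤ (S \ A).card * 2 := by
    apply Finset.card_mul_le_card_mul (fun t s => dist t s < l)
    · intro u hu
      have : ∃ t ∈ T \ S, dist u (f t) < l ∧ dist u (g t) < l := by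
        by_cases huS : u ∈ S
        · have huT := (Finset.mem_sdiff.1 hu).1
          have : ¬ ∀ t ∈ T \ S, u ≠ f t ∧ u ≠ g t := fun h =>
            (Finset.mem_sdiff.1 hu).2 (Finset.mem_filter.2 ⟨Finset.mem_inter.2 ⟨huS, huT⟩, h⟩)
          push Not at this
          obtain ⟨t, ht, h⟩ := this
          have h3' := h3 t ht
          have hl0 : 0 < l := lt_of_le_of_lt dist_nonneg h3'
          refine ⟨t, ht, ?_⟩
          by_cases huf : u = f t
          · rw [huf, dist_self]; exact ⟨hl0, h3'⟩
          · rw [h huf, dist_self, dist_comm]; exact ⟨h3', hl0⟩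
        · have hut : u ∈ T \ S := Finset.mem_sdiff.2 ⟨(Finset.mem_sdiff.1 hu).1, huS⟩
          exact ⟨u, hut, h1 u hut, h2 u hut⟩
      obtain ⟨t, ht, d1, d2⟩ := this
      have : 1 < (Finset.bipartiteAbove (fun t s => dist t s < l) (S \ A) u).card :=
        Finset.one_lt_card.2 ⟨f t, Finset.mem_filter.2 ⟨hfA t ht, d1⟩, g t,
          Finset.mem_filter.2 ⟨hgA t ht, d2⟩, hfg t ht⟩
      exact this
    · intro q hq
      by_contra hlt
      push Not at hlt
      obtain ⟨a, b, c, ha, hb, hc, hab, hac, hbc⟩ := Finset.two_lt_card_iff.1 hlt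
      simp only [Finset.bipartiteBelow, Finset.mem_filter, Finset.mem_sdiff] at ha hb hc
      exact tri_geom hl ha.2 hb.2 hc.2
        (hT a ha.1.1 b hb.1.1 c hc.1.1 hab.symm hac.symm hbc)
        (hT b hb.1.1 a ha.1.1 c hc.1.1 hab hbc.symm hac)
        (hT c hc.1.1 a ha.1.1 b hb.1.1 hac hbc hab)
  rw [Finset.card_sdiff_of_subset hAS, Finset.card_sdiff_of_subset hAT] at hmain
  have := Finset.card_le_card hAS
  have := Finset.card_le_card hAT
  omega

/-- the greedy algorithm is a `(2√3 + ε)`-factor approximation for the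
2-dispersion problem in the plane. -/
theorem greedy_two_dispersion_approx
    (P : Finset (EuclideanSpace ℝ (Fin 2))) (k : ℕ)
    (hk3 : 3 ≤ k) (hkn : k ≤ P.card)
    (ε : ℝ) (hε : 0 < ε)
    (S : ℕ → Finset (EuclideanSpace ℝ (Fin 2)))
    (hS3sub : S 3 ⊆ P) (hS3card : (S 3).card = 3)
    (hS3max : ∀ T ⊆ P, T.card = 3 → cost2 T ≤ cost2 (S 3))
    (hstep : ∀ i, 3 ≤ i → i < k →
      ∃ p ∈ P \ S i, S (i + 1) = insert p (S i) ∧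
        ∀ q ∈ P \ S i, cost2 (insert q (S i)) ≤ cost2 (insert p (S i)))
    (T : Finset (EuclideanSpace ℝ (Fin 2))) (hT : T ⊆ P) (hTcard : T.card = k) :
    cost2 T ≤ (2 * Real.sqrt 3 + ε) * cost2 (S k) := by
  have hs : 1 ≤ Real.sqrt 3 := Real.one_le_sqrt.2 (by norm_num)
  obtain ⟨l, hl⟩ : ∃ l, cost2 T = 2 * Real.sqrt 3 * l :=
    ⟨cost2 T / (2 * Real.sqrt 3), by field_simp⟩
  have hO := cost2_nonneg T
  have inv : ∀ i, 3 ≤ i → i ≤ k → (S i).card = i ∧ l ≤ cost2 (S i) := by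
    intro i hi
    induction i, hi using Nat.le_induction with
    | base =>
      intro _
      refine ⟨hS3card, ?_⟩
      obtain ⟨T3, hsub, hc⟩ := Finset.exists_subset_card_eq (hTcard ▸ hk3 : 3 ≤ T.card)
      have h1 := hS3max T3 (hsub.trans hT) hc
      have h2 : cost2 T ≤ cost2 T3 := le_cost2 hc.ge (fun p hp q hq r hr =>
        tripGe_cost2 T p (hsub hp) q (hsub hq) r (hsub hr))
      have hl0 : 0 ≤ l := by
        by_contra h
        push Not at h
        nlinarith
      nlinarith
    | succ i hi ih =>
      intro hik
      obtain ⟨hc, hli⟩ := ih (by omega)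
      obtain ⟨p, hp, heq, hmax⟩ := hstep i hi (by omega)
      have htrip : TripGe l (S i) := fun p hp q hq r hr h1 h2 h3 =>
        hli.trans (tripGe_cost2 (S i) p hp q hq r hr h1 h2 h3)
      obtain ⟨t, ht, htt⟩ := step hl (by omega : (S i).card < T.card) htrip (tripGe_cost2 T)
      rw [Finset.mem_sdiff] at ht hp
      have hcp : (insert p (S i)).card = i + 1 := by
        rw [Finset.card_insert_of_notMem hp.2, hc]
      have hct : (insert t (S i)).card = i + 1 := by
        rw [Finset.card_insert_of_notMem ht.2, hc]
      rw [heq]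
      refine ⟨hcp, ?_⟩
      exact (le_cost2 (by omega) htt).trans (hmax t (Finset.mem_sdiff.2 ⟨hT ht.1, ht.2⟩))
  have hfin := (inv k hk3 le_rfl).2
  have h0 := cost2_nonneg (S k)
  rw [hl]
  have : 2 * Real.sqrt 3 * l ≤ 2 * Real.sqrt 3 * cost2 (S k) := by gcongr
  nlinarith
end

section
/- Let S be a finite set of points in the Euclidean plane with |S| ≥ 3 and let ε > 0. Then for every point x of ℝ², at most two points of S lie at Euclidean distance at most cost₂(S)/(2√3+ε) from x; that is, any closed disk of radius cost₂(S)/(2√3+ε) contains at most two points of S. -/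
open scoped Classical

theorem cost2_le_aux (S : Finset (EuclideanSpace ℝ (Fin 2)))
    (p q q' : EuclideanSpace ℝ (Fin 2)) (hp : p ∈ S) (hq : q ∈ S) (hq' : q' ∈ S)
    (h1 : q ≠ p) (h2 : q' ≠ p) (h3 : q ≠ q') : cost2 S ≤ dist p q + dist p q' := by
  have hb : ∀ p : EuclideanSpace ℝ (Fin 2), 0 ≤ cost2At p S := by
    intro p
    apply Real.sInf_nonneg
    rintro y ⟨a, _, b, _, _, rfl⟩
    positivity
  have e1 : cost2 S ≤ cost2At p S := by
    apply csInf_le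
    · refine ⟨0, ?_⟩
      rintro y ⟨a, _, rfl⟩
      exact hb a
    · exact ⟨p, hp, rfl⟩
  refine e1.trans ?_
  apply csInf_le
  · refine ⟨0, ?_⟩
    rintro y ⟨a, _, b, _, _, rfl⟩
    positivity
  · exact ⟨q, Finset.mem_erase.2 ⟨h1, hq⟩, q', Finset.mem_erase.2 ⟨h2, hq'⟩, h3, rfl⟩

theorem sum_sq_aux (x a b c : EuclideanSpace ℝ (Fin 2)) :
    dist a b ^ 2 + dist b c ^ 2 + dist a c ^ 2
      ≤ 3 * (dist x a ^ 2 + dist x b ^ 2 + dist x c ^ 2) := by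
  simp only [EuclideanSpace.dist_eq, Fin.sum_univ_two, Real.dist_eq, sq_abs]
  rw [Real.sq_sqrt (by positivity), Real.sq_sqrt (by positivity), Real.sq_sqrt (by positivity),
    Real.sq_sqrt (by positivity), Real.sq_sqrt (by positivity), Real.sq_sqrt (by positivity)]
  nlinarith [sq_nonneg (a 0 + b 0 + c 0 - 3 * x 0), sq_nonneg (a 1 + b 1 + c 1 - 3 * x 1)]

/-- any closed disk of radius `cost₂(S)/(2√3 + ε)` contains at most two
points of `S`. -/
theorem disk_contains_at_most_two
    (S : Finset (EuclideanSpace ℝ (Fin 2))) (hS : 3 ≤ S.card)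
    (ε : ℝ) (hε : 0 < ε) (x : EuclideanSpace ℝ (Fin 2)) :
    (S.filter fun p => dist x p ≤ cost2 S / (2 * Real.sqrt 3 + ε)).card ≤ 2 := by
  by_contra! h
  obtain ⟨a, b, c, ha, hb, hc, hab, hac, hbc⟩ := Finset.two_lt_card_iff.1 h
  rw [Finset.mem_filter] at ha hb hc
  obtain ⟨haS, ha⟩ := ha
  obtain ⟨hbS, hb⟩ := hb
  obtain ⟨hcS, hc⟩ := hc
  set r := cost2 S / (2 * Real.sqrt 3 + ε) with hr
  have hs : 0 < Real.sqrt 3 := by positivity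
  have hs2 : Real.sqrt 3 ^ 2 = 3 := Real.sq_sqrt (by norm_num)
  have hC : cost2 S = r * (2 * Real.sqrt 3 + ε) := by
    rw [hr]; field_simp
  have hrpos : 0 < r := by
    by_contra! h0
    have h1 : dist x a = 0 := le_antisymm (ha.trans h0) dist_nonneg
    have h2 : dist x b = 0 := le_antisymm (hb.trans h0) dist_nonneg
    exact hab ((dist_eq_zero.1 h1).symm.trans (dist_eq_zero.1 h2))
  have k1 := cost2_le_aux S a b c haS hbS hcS hab.symm hac.symm hbc
  have k2 := cost2_le_aux S b a c hbS haS hcS hab hbc.symm hac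
  have k3 := cost2_le_aux S c a b hcS haS hbS hac hbc hab
  rw [dist_comm b a] at k2
  rw [dist_comm c a, dist_comm c b] at k3
  have key := sum_sq_aux x a b c
  have q1 : dist x a ^ 2 ≤ r ^ 2 := pow_le_pow_left₀ dist_nonneg ha 2
  have q2 : dist x b ^ 2 ≤ r ^ 2 := pow_le_pow_left₀ dist_nonneg hb 2
  have q3 : dist x c ^ 2 ≤ r ^ 2 := pow_le_pow_left₀ dist_nonneg hc 2
  have hP : dist a b + dist b c + dist a c ≤ 3 * Real.sqrt 3 * r := by
    refine abs_le_of_sq_le_sq' ?_ (by positivity) |>.2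
    have e : (3 * Real.sqrt 3 * r) ^ 2 = 27 * r ^ 2 := by
      rw [mul_pow, mul_pow, hs2]; ring
    rw [e]
    nlinarith [sq_nonneg (dist a b - dist b c), sq_nonneg (dist b c - dist a c),
      sq_nonneg (dist a b - dist a c)]
  have : 0 < r * ε := mul_pos hrpos hε
  nlinarith
end

section
/- Let OPT and S be finite sets of points in the Euclidean plane with |OPT| = k and |S| < k, and let r > 0. Suppose that for every point p ∈ S, at most two points of OPT lie at Euclidean distance at most r from p. Then there exists a point q ∈ OPT such that at most one point of S lies at Euclidean distance at most r from q. -/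
open scoped Classical

/-- bipartite double-counting lemma.  If every point of `S` has at most
two points of `OPT` within distance `r`, and `|OPT| = k > |S|`, then some point of
`OPT` has at most one point of `S` within distance `r`. -/
theorem double_counting_disks
    (OPT S : Finset (EuclideanSpace ℝ (Fin 2))) (k : ℕ)
    (hOPT : OPT.card = k) (hS : S.card < k) (r : ℝ) (hr : 0 < r)
    (h : ∀ p ∈ S, (OPT.filter fun q => dist p q ≤ r).card ≤ 2) :
    ∃ q ∈ OPT, (S.filter fun p => dist q p ≤ r).card ≤ 1 := by
  by_contra! hc
  have h1 : OPT.card * 2 ≤ S.card * 2 := by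
    refine Finset.card_mul_le_card_mul (fun q p => dist q p ≤ r) (fun q hq => ?_) (fun p hp => ?_)
    · have := hc q hq
      unfold Finset.bipartiteAbove
      exact this
    · have := h p hp
      simp only [dist_comm p] at this
      unfold Finset.bipartiteBelow
      exact this
  omega
end

section
/- Let S be a finite set of points in the Euclidean plane with |S| ≥ 3. Let s_o ∈ S be a point attaining the minimum, i.e. cost₂(s_o, S) = cost₂(S), and let s_r, s_t ∈ S∖{s_o} be its first and second closest points in S∖{s_o}: s_r ≠ s_t, d(s_o,s_r) ≤ d(s_o,s_t), d(s_o,s_t) ≤ d(s_o,q) for every q ∈ S∖{s_o,s_r,s_t}, and cost₂(S) = d(s_o,s_r)+d(s_o,s_t). Then no point of S∖{s_o,s_r,s_t} lies in the interior of the convex hull of {s_o, s_r, s_t} (the triangle with vertices s_o, s_r, s_t). -/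
open scoped Classical

/-- the triangle formed by a solution point `s_o` and its two supporting
points `s_r`, `s_t` contains no other point of `S` in its interior. -/
theorem no_point_in_solution_triangle
    (S : Finset (EuclideanSpace ℝ (Fin 2))) (hS : 3 ≤ S.card)
    (so sr st : EuclideanSpace ℝ (Fin 2))
    (hso : so ∈ S) (hsr : sr ∈ S) (hst : st ∈ S)
    (hsor : sr ≠ so) (hsot : st ≠ so) (hrt : sr ≠ st)
    (hmin : cost2At so S = cost2 S)
    (horder : dist so sr ≤ dist so st)
    (hsecond : ∀ q ∈ S, q ≠ so → q ≠ sr → q ≠ st → dist so st ≤ dist so q)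
    (hcost : cost2 S = dist so sr + dist so st) :
    ∀ q ∈ S, q ≠ so → q ≠ sr → q ≠ st →
      q ∉ interior (convexHull ℝ ({so, sr, st} : Set (EuclideanSpace ℝ (Fin 2)))) := by
  intro q hq hqo hqr hqt hmem
  have hpos : 0 < dist so st := dist_pos.mpr hsot.symm
  have hsub : convexHull ℝ ({so, sr, st} : Set (EuclideanSpace ℝ (Fin 2))) ⊆
      Metric.closedBall so (dist so st) := by
    apply convexHull_min _ (convex_closedBall _ _)
    rintro x (rfl | rfl | rfl)
    · exact Metric.mem_closedBall_self hpos.le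
    · rw [Metric.mem_closedBall']; exact horder
    · rw [Metric.mem_closedBall']
  have h := interior_mono hsub hmem
  rw [interior_closedBall _ hpos.ne', Metric.mem_ball'] at h
  exact absurd (hsecond q hq hqo hqr hqt) (not_le.mpr h)
end

section
/- Let S be a finite set of points in the Euclidean plane with |S| ≥ 3, and let ρ > 0 satisfy cost₂(S) ≥ 2√3·ρ. Then for every point x of ℝ², at most three points of S lie at Euclidean distance at most ρ from x; moreover, if three pairwise distinct points of S lie at distance at most ρ from x, then each of these three points lies at distance exactly ρ from x (on the boundary circle of the disk). -/
open scoped Classical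

theorem aux_cost (S : Finset (EuclideanSpace ℝ (Fin 2))) {p q r : EuclideanSpace ℝ (Fin 2)}
    (hp : p ∈ S) (hq : q ∈ S) (hr : r ∈ S) (hpq : p ≠ q) (hpr : p ≠ r) (hqr : q ≠ r) :
    cost2 S ≤ dist p q + dist p r := by
  have h1 : cost2 S ≤ cost2At p S := by
    apply csInf_le
    · refine ⟨0, ?_⟩
      rintro y ⟨p', -, rfl⟩
      apply Real.sInf_nonneg
      rintro z ⟨q, -, q', -, -, rfl⟩
      positivity
    · exact ⟨p, hp, rfl⟩
  refine h1.trans ?_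
  apply csInf_le
  · refine ⟨0, ?_⟩
    rintro z ⟨q, -, q', -, -, rfl⟩
    positivity
  · exact ⟨q, Finset.mem_erase.2 ⟨hpq.symm, hq⟩, r, Finset.mem_erase.2 ⟨hpr.symm, hr⟩, hqr, rfl⟩

theorem aux_id (u v w : EuclideanSpace ℝ (Fin 2)) :
    ‖u - v‖ ^ 2 + ‖v - w‖ ^ 2 + ‖u - w‖ ^ 2 + ‖u + v + w‖ ^ 2
      = 3 * (‖u‖ ^ 2 + ‖v‖ ^ 2 + ‖w‖ ^ 2) := by
  simp only [norm_sub_sq_real, norm_add_sq_real, inner_add_left]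
  ring

theorem aux_key (S : Finset (EuclideanSpace ℝ (Fin 2)))
    (ρ : ℝ) (hρ : 0 < ρ) (hcost : 2 * Real.sqrt 3 * ρ ≤ cost2 S)
    (x a b c : EuclideanSpace ℝ (Fin 2)) (ha : a ∈ S) (hb : b ∈ S) (hc : c ∈ S)
    (hab : a ≠ b) (hac : a ≠ c) (hbc : b ≠ c)
    (xa : dist x a ≤ ρ) (xb : dist x b ≤ ρ) (xc : dist x c ≤ ρ) :
    (dist x a = ρ ∧ dist x b = ρ ∧ dist x c = ρ) ∧ (x - a) + (x - b) + (x - c) = 0 := by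
  have h1 := hcost.trans (aux_cost S ha hb hc hab hac hbc)
  have h2 := hcost.trans (aux_cost S hb ha hc hab.symm hbc hac)
  have h3 := hcost.trans (aux_cost S hc ha hb hac.symm hbc.symm hab)
  rw [dist_comm b a] at h2
  rw [dist_comm c a, dist_comm c b] at h3
  have id := aux_id (x - a) (x - b) (x - c)
  rw [sub_sub_sub_cancel_left, sub_sub_sub_cancel_left, sub_sub_sub_cancel_left,
    ← dist_eq_norm x a, ← dist_eq_norm x b, ← dist_eq_norm x c, ← dist_eq_norm b a,
    ← dist_eq_norm c b, ← dist_eq_norm c a, dist_comm b a, dist_comm c a, dist_comm c b] at id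
  have hP : 3 * (√3 * ρ) ≤ dist a b + dist b c + dist a c := by linarith
  have h0 : 0 ≤ √3 * ρ := by positivity
  have hs : (√3 * ρ) ^ 2 = 3 * ρ ^ 2 := by
    rw [mul_pow, Real.sq_sqrt (by norm_num)]
  have hP2 : (3 * (√3 * ρ)) ^ 2 ≤ (dist a b + dist b c + dist a c) ^ 2 :=
    pow_le_pow_left₀ (by positivity) hP 2
  have hQ : 9 * ρ ^ 2 ≤ dist a b ^ 2 + dist b c ^ 2 + dist a c ^ 2 := by
    nlinarith [sq_nonneg (dist a b - dist b c), sq_nonneg (dist a b - dist a c),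
      sq_nonneg (dist b c - dist a c)]
  have qa : dist x a ^ 2 ≤ ρ ^ 2 := pow_le_pow_left₀ dist_nonneg xa 2
  have qb : dist x b ^ 2 ≤ ρ ^ 2 := pow_le_pow_left₀ dist_nonneg xb 2
  have qc : dist x c ^ 2 ≤ ρ ^ 2 := pow_le_pow_left₀ dist_nonneg xc 2
  have hn := sq_nonneg ‖(x - a) + (x - b) + (x - c)‖
  refine ⟨⟨?_, ?_, ?_⟩, ?_⟩
  · exact le_antisymm xa ((sq_le_sq₀ hρ.le dist_nonneg).1 (by linarith))
  · exact le_antisymm xb ((sq_le_sq₀ hρ.le dist_nonneg).1 (by linarith))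
  · exact le_antisymm xc ((sq_le_sq₀ hρ.le dist_nonneg).1 (by linarith))
  · rw [← norm_eq_zero]
    exact pow_eq_zero_iff (two_ne_zero) |>.1 (le_antisymm (by linarith) hn)

/-- if `cost₂(S) ≥ 2√3·ρ`, any closed disk of radius `ρ` contains at
most three points of `S`; and if it contains three pairwise distinct points of `S`,
they all lie on its boundary circle. -/
theorem closed_disk_at_most_three_on_boundary
    (S : Finset (EuclideanSpace ℝ (Fin 2))) (hS : 3 ≤ S.card)
    (ρ : ℝ) (hρ : 0 < ρ) (hcost : 2 * Real.sqrt 3 * ρ ≤ cost2 S)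
    (x : EuclideanSpace ℝ (Fin 2)) :
    (S.filter fun p => dist x p ≤ ρ).card ≤ 3 ∧
      ∀ a ∈ S, ∀ b ∈ S, ∀ c ∈ S, a ≠ b → a ≠ c → b ≠ c →
        dist x a ≤ ρ → dist x b ≤ ρ → dist x c ≤ ρ →
        dist x a = ρ ∧ dist x b = ρ ∧ dist x c = ρ := by
  have key := aux_key S ρ hρ hcost x
  refine ⟨?_, fun a ha b hb c hc hab hac hbc xa xb xc =>
    (key a b c ha hb hc hab hac hbc xa xb xc).1⟩
  by_contra hcon
  obtain ⟨T, hT, hT4⟩ := Finset.exists_subset_card_eq (show 4 ≤ _ from not_le.1 hcon)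
  obtain ⟨a, b, c, d, hab, hac, had, hbc, hbd, hcd, rfl⟩ := Finset.card_eq_four.1 hT4
  have ma := Finset.mem_filter.1 (hT (show a ∈ _ by simp))
  have mb := Finset.mem_filter.1 (hT (show b ∈ _ by simp))
  have mc := Finset.mem_filter.1 (hT (show c ∈ _ by simp))
  have md := Finset.mem_filter.1 (hT (show d ∈ _ by simp))
  have e1 := (key a b c ma.1 mb.1 mc.1 hab hac hbc ma.2 mb.2 mc.2).2
  have e2 := (key a b d ma.1 mb.1 md.1 hab had hbd ma.2 mb.2 md.2).2
  exact hcd (sub_right_injective (add_left_cancel (e1.trans e2.symm)))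
end

section
/- Let S* be a finite set of k points in the Euclidean plane with k ≥ 3, and let ρ > 0 satisfy cost₂(S*) ≥ 2√3·ρ. Let S be a finite set of points in ℝ² with |S| ≥ 3, cost₂(S) ≥ ρ and |S| < k. Then there exists a point q ∈ S* such that at most one point of S lies at Euclidean distance strictly less than ρ from q; that is, at least one of the k open disks of radius ρ centered at the points of S* properly contains at most one point of S. -/
open scoped Classical

theorem cost2_le_aux_s8 (S : Finset (EuclideanSpace ℝ (Fin 2)))
    (a b c : EuclideanSpace ℝ (Fin 2)) (ha : a ∈ S) (hb : b ∈ S) (hc : c ∈ S)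
    (hab : b ≠ a) (hac : c ≠ a) (hbc : b ≠ c) : cost2 S ≤ dist a b + dist a c := by
  have h1 : cost2At a S ≤ dist a b + dist a c := by
    apply csInf_le
    · refine ⟨0, ?_⟩
      rintro x ⟨q, -, q', -, -, rfl⟩
      positivity
    · exact ⟨b, Finset.mem_erase.2 ⟨hab, hb⟩, c, Finset.mem_erase.2 ⟨hac, hc⟩, hbc, rfl⟩
  refine le_trans ?_ h1
  apply csInf_le
  · refine ⟨0, ?_⟩
    rintro x ⟨p, -, rfl⟩
    apply Real.sInf_nonneg
    rintro x ⟨q, -, q', -, -, rfl⟩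
    positivity
  · exact ⟨a, ha, rfl⟩

theorem three_pts_aux (p a b c : EuclideanSpace ℝ (Fin 2)) (ρ : ℝ) (hρ : 0 < ρ)
    (ha : dist a p < ρ) (hb : dist b p < ρ) (hc : dist c p < ρ) :
    dist a b ^ 2 + dist b c ^ 2 + dist c a ^ 2 < 9 * ρ ^ 2 := by
  have ha2 : dist a p ^ 2 < ρ ^ 2 := by gcongr
  have hb2 : dist b p ^ 2 < ρ ^ 2 := by gcongr
  have hc2 : dist c p ^ 2 < ρ ^ 2 := by gcongr
  simp only [EuclideanSpace.dist_sq_eq, Fin.sum_univ_two, Real.dist_eq, sq_abs] at *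
  nlinarith [sq_nonneg (a 0 + b 0 + c 0 - 3 * p 0), sq_nonneg (a 1 + b 1 + c 1 - 3 * p 1)]

/-- if `cost₂(S*) ≥ 2√3·ρ`, `cost₂(S) ≥ ρ` and `|S| < |S*| = k`, then
some open disk of radius `ρ` centered at a point of `S*` properly contains at most
one point of `S`. -/
theorem exists_disk_properly_containing_at_most_one
    (Sstar : Finset (EuclideanSpace ℝ (Fin 2))) (k : ℕ)
    (hk : 3 ≤ k) (hSstar : Sstar.card = k)
    (ρ : ℝ) (hρ : 0 < ρ) (hcoststar : 2 * Real.sqrt 3 * ρ ≤ cost2 Sstar)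
    (S : Finset (EuclideanSpace ℝ (Fin 2))) (hS : 3 ≤ S.card)
    (hcostS : ρ ≤ cost2 S) (hSk : S.card < k) :
    ∃ q ∈ Sstar, (S.filter fun p => dist q p < ρ).card ≤ 1 := by
  by_contra hcon
  push Not at hcon
  have key := Finset.card_mul_le_card_mul (s := Sstar) (t := S) (m := 2) (n := 2)
    (fun q p => dist q p < ρ) (fun q hq => hcon q hq) (by
      intro p hp
      by_contra hlt
      push Not at hlt
      obtain ⟨a, ha, b, hb, c, hc, hab, hac, hbc⟩ := Finset.two_lt_card.1 hlt
      simp only [Finset.bipartiteBelow, Finset.mem_filter] at ha hb hc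
      have h := three_pts_aux p a b c ρ hρ ha.2 hb.2 hc.2
      have h1 := cost2_le_aux_s8 Sstar a b c ha.1 hb.1 hc.1 hab.symm hac.symm hbc
      have h2 := cost2_le_aux_s8 Sstar b c a hb.1 hc.1 ha.1 hbc.symm hab hac.symm
      have h3 := cost2_le_aux_s8 Sstar c a b hc.1 ha.1 hb.1 hac hbc hab
      rw [dist_comm a c] at h1
      rw [dist_comm b a] at h2
      rw [dist_comm c b] at h3
      have hP : 3 * Real.sqrt 3 * ρ ≤ dist a b + dist b c + dist c a := by linarith
      have h4 : (3 * Real.sqrt 3 * ρ) ^ 2 ≤ (dist a b + dist b c + dist c a) ^ 2 := by gcongr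
      have h5 : (3 * Real.sqrt 3 * ρ) ^ 2 = 27 * ρ ^ 2 := by
        rw [mul_pow, mul_pow, Real.sq_sqrt (by norm_num)]; norm_num
      nlinarith [sq_nonneg (dist a b - dist b c), sq_nonneg (dist b c - dist c a),
        sq_nonneg (dist c a - dist a b)])
  omega
end

section
/- Let S* be a finite set of k points in the Euclidean plane with k ≥ 2, let ρ > 0 satisfy cost₁(S*) ≥ 2ρ, and let M be a finite set of points in ℝ² with cost₁(M) ≥ ρ and |M| < k. Then there exists a point q ∈ S* such that no point of M lies at Euclidean distance strictly less than ρ from q; that is, at least one of the k open disks of radius ρ centered at the points of S* properly contains no point of M. -/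
open scoped Classical

/-- `cost₁(S)`: the minimum of `d(p,q)` over all pairs of distinct points
`p, q ∈ S`. -/
noncomputable def cost1 (S : Finset (EuclideanSpace ℝ (Fin 2))) : ℝ :=
  sInf {x : ℝ | ∃ p ∈ S, ∃ q ∈ S, p ≠ q ∧ x = dist p q}

/-- if `cost₁(S*) ≥ 2ρ`, `cost₁(M) ≥ ρ` and `|M| < |S*| = k`, then some
open disk of radius `ρ` centered at a point of `S*` properly contains no point of
`M`. -/
theorem exists_disk_properly_containing_no_point
    (Sstar : Finset (EuclideanSpace ℝ (Fin 2))) (k : ℕ)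
    (hk : 2 ≤ k) (hSstar : Sstar.card = k)
    (ρ : ℝ) (hρ : 0 < ρ) (hcoststar : 2 * ρ ≤ cost1 Sstar)
    (M : Finset (EuclideanSpace ℝ (Fin 2)))
    (hcostM : ρ ≤ cost1 M) (hMk : M.card < k) :
    ∃ q ∈ Sstar, (M.filter fun p => dist q p < ρ).card = 0 := by
  by_contra! hcon
  have h : ∀ q ∈ Sstar, ∃ p ∈ M, dist q p < ρ := by
    intro q hq
    obtain ⟨p, hp⟩ := Finset.card_pos.mp (Nat.pos_of_ne_zero (hcon q hq))
    exact ⟨p, (Finset.mem_filter.mp hp).1, (Finset.mem_filter.mp hp).2⟩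
  choose! f hfM hfd using h
  obtain ⟨x, hx, y, hy, hxy, hf⟩ :=
    Finset.exists_ne_map_eq_of_card_lt_of_maps_to (by omega : M.card < Sstar.card) hfM
  have h1 : cost1 Sstar ≤ dist x y := by
    refine csInf_le ⟨0, ?_⟩ ⟨x, hx, y, hy, hxy, rfl⟩
    rintro _ ⟨p, _, q, _, _, rfl⟩
    exact dist_nonneg
  have h2 := hfd x hx
  have h3 := hfd y hy
  rw [← hf] at h3
  have h4 := dist_triangle_right x y (f x)
  linarith
end
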